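/- Let X be a simply connected simplicial complex and G a group acting simplicially on X. Let G_* be the normal subgroup of G generated by all elements with nonempty fixed-point set in X. Then the fundamental group of the quotient space X/G is isomorphic to G/G_*. -/

import Mathlib

open scoped BigOperators

/-- The geometric realization of the abstract simplicial complex with faces `K` on the
vertex set `V`: convex combinations of vertices supported on a face. -/
def geomReal {V : Type} (K : Set (Finset V)) : Set (V → ℝ) :=
  {f | (∀ v, 0 ≤ f v) ∧ ∃ s ∈ K, (∀ v, v ∉ s → f v = 0) ∧ ∑ v ∈ s, f v = 1}

/-- The simplicial action of `g` (acting on vertices via `ρ`) on points of the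
realization. -/
def simpAct {G V : Type} [Group G] (ρ : G →* Equiv.Perm V) (g : G) (f : V → ℝ) :
    V → ℝ :=
  fun v => f ((ρ g).symm v)

/-- The relation on the realization identifying points in the same `G`-orbit; the
quotient `Quot` of it is the orbit space `X/G`. -/
def orbitRel' {G V : Type} [Group G] (K : Set (Finset V)) (ρ : G →* Equiv.Perm V) :
    geomReal K → geomReal K → Prop :=
  fun p q => ∃ g : G, simpAct ρ g ↑p = ↑q

open scoped unitInterval
open Topology

/-- Every homotopy-lifting problem for the path `c` along `q` has a solution, up to homotopy
relative to the endpoints, with prescribed initial point. -/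
def LiftsUpToHomotopy {X Y : Type*} [TopologicalSpace X] [TopologicalSpace Y] (q : C(X, Y))
    {a b : Y} (c : Path a b) : Prop :=
  ∀ (x : X) (hx : q x = a), ∃ (x' : X) (hx' : q x' = b) (Γ : Path x x'),
    ((Γ.map q.continuous).cast hx.symm hx'.symm).Homotopic c

namespace LiftsUpToHomotopy

variable {X Y : Type*} [TopologicalSpace X] [TopologicalSpace Y] {q : C(X, Y)} {a b d : Y}

lemma refl : LiftsUpToHomotopy q (Path.refl a) := by
  rintro x rfl
  exact ⟨x, rfl, Path.refl x, .refl _⟩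

lemma trans {c : Path a b} {c' : Path b d} (hc : LiftsUpToHomotopy q c)
    (hc' : LiftsUpToHomotopy q c') : LiftsUpToHomotopy q (c.trans c') := by
  intro x hx
  obtain ⟨y, rfl, Γ, hΓ⟩ := hc x hx
  obtain ⟨z, rfl, Γ', hΓ'⟩ := hc' y rfl
  refine ⟨z, rfl, Γ.trans Γ', ?_⟩
  subst hx
  rw [Path.map_trans]
  exact hΓ.hcomp hΓ'

lemma of_homotopic {c c' : Path a b} (hc : LiftsUpToHomotopy q c) (h : c.Homotopic c') :
    LiftsUpToHomotopy q c' := by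
  intro x hx
  obtain ⟨x', hx', Γ, hΓ⟩ := hc x hx
  exact ⟨x', hx', Γ, hΓ.trans h⟩

lemma of_local
    (hloc : ∀ y : Y, ∃ V : Set Y, IsOpen V ∧ y ∈ V ∧
      ∀ {a b : Y} (c : Path a b), Set.range c ⊆ V → LiftsUpToHomotopy q c)
    (c : Path a b) : LiftsUpToHomotopy q c := by
  choose V hVo hyV hV using hloc
  obtain ⟨t, ht0, hmono, ⟨n, hn⟩, ht⟩ := exists_monotone_Icc_subset_open_cover_unitInterval
    (c := fun y => c ⁻¹' V y) (fun y => (hVo y).preimage c.continuous)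
    (fun s _ => Set.mem_iUnion.2 ⟨c s, hyV _⟩)
  have key : ∀ m, LiftsUpToHomotopy q (c.subpath 0 (t m)) := by
    intro m
    induction m with
    | zero => rw [ht0, Path.subpath_self]; exact refl
    | succ m ih =>
      obtain ⟨y, hy⟩ := ht m
      refine (ih.trans (hV y (c.subpath (t m) (t (m + 1))) ?_)).of_homotopic
        ⟨Path.Homotopy.subpathTransSubpath ..⟩
      rw [Path.range_subpath_of_le _ _ _ (hmono m.le_succ)]
      exact Set.image_subset_iff.2 hy
  have h1 := key n
  rw [hn n le_rfl, Path.subpath_zero_one] at h1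
  intro x hx
  obtain ⟨x', hx', Γ, hΓ⟩ := h1 x (by simpa using hx)
  exact ⟨x', by simpa using hx', Γ, hΓ⟩

end LiftsUpToHomotopy

/-- Every point `p` has an open neighbourhood `U` that contracts to `p` compatibly with all
elements of `G` that identify points of `U`. -/
def HasEquivariantContractions (G X : Type*) [TopologicalSpace X] [SMul G X] : Prop :=
  ∀ p : X, ∃ U : Set X, IsOpen U ∧ p ∈ U ∧ ∃ h : C(U × I, U),
    (∀ u, h (u, 0) = u) ∧ (∀ u, (h (u, 1) : X) = p) ∧
    ∀ (g : G) (u u' : U), g • (u : X) = u' → ∀ t, g • (h (u, t) : X) = h (u', t)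

lemma HasEquivariantContractions.subgroup {G X : Type*} [TopologicalSpace X] [Group G]
    [MulAction G X] (hX : HasEquivariantContractions G X) (N : Subgroup G) :
    HasEquivariantContractions N X := by
  intro p
  obtain ⟨U, hU, hp, h, h0, h1, hg⟩ := hX p
  exact ⟨U, hU, hp, h, h0, h1, fun g => hg g⟩

section Orbit

variable {G X Y : Type*} [TopologicalSpace X] [TopologicalSpace Y] [Group G] [MulAction G X]
  [ContinuousConstSMul G X] {q : C(X, Y)}

omit [ContinuousConstSMul G X] in
/-- The image in the orbit space of an equivariantly contractible open set is contractible. -/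
lemma contractibleSpace_image (hq : IsOpenQuotientMap q)
    (hqG : ∀ a b : X, q a = q b ↔ a ∈ MulAction.orbit G b) {U : Set X} (hU : IsOpen U) {p : X}
    (hp : p ∈ U) (h : C(U × I, U)) (h0 : ∀ u, h (u, 0) = u) (h1 : ∀ u, (h (u, 1) : X) = p)
    (hh : ∀ (g : G) (u u' : U), g • (u : X) = u' → ∀ t, g • (h (u, t) : X) = h (u', t)) :
    ContractibleSpace (q '' U) := by
  let qU : U → q '' U := fun u => ⟨q u, u, u.2, rfl⟩
  have hqU : IsOpenQuotientMap qU :=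
    { surjective := by rintro ⟨_, u, hu, rfl⟩; exact ⟨⟨u, hu⟩, rfl⟩
      continuous := by fun_prop
      isOpenMap := (hq.isOpenMap.comp hU.isOpenMap_subtype_val).subtype_mk _ }
  have hprod : IsOpenQuotientMap (Prod.map qU (id : I → I)) := hqU.prodMap .id
  have hfac : Function.FactorsThrough (fun ut => qU (h ut)) (Prod.map qU (id : I → I)) := by
    rintro ⟨u, t⟩ ⟨u', t'⟩ heq
    obtain ⟨hu, rfl : t = t'⟩ := Prod.ext_iff.1 heq
    obtain ⟨g, hg⟩ := (hqG _ _).1 (congrArg Subtype.val hu)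
    refine Subtype.ext ((hqG _ _).2 ⟨g, hh g u' u hg t⟩)
  let K : C((q '' U) × I, q '' U) :=
    hprod.isQuotientMap.lift (f := ⟨_, hprod.continuous⟩)
      ⟨fun ut => qU (h ut), hqU.continuous.comp h.continuous⟩ hfac
  have hK : ∀ u t, K (qU u, t) = qU (h (u, t)) := fun u t =>
    congrArg (fun f : C(U × I, q '' U) => f (u, t)) (hprod.isQuotientMap.lift_comp
      (f := ⟨_, hprod.continuous⟩) ⟨fun ut => qU (h ut), hqU.continuous.comp h.continuous⟩ hfac)
  rw [contractible_iff_id_nullhomotopic]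
  refine ⟨qU ⟨p, hp⟩, ⟨⟨K.comp .prodSwap, fun y => ?_, fun y => ?_⟩⟩⟩
  · obtain ⟨u, rfl⟩ := hqU.surjective y
    change K (qU u, 0) = qU u
    rw [hK, h0]
  · obtain ⟨u, rfl⟩ := hqU.surjective y
    change K (qU u, 1) = _
    rw [hK]
    exact congrArg qU (Subtype.ext (h1 u))

/-- Paths in the orbit space lift up to homotopy. -/
lemma HasEquivariantContractions.liftsUpToHomotopy (hX : HasEquivariantContractions G X)
    (hq : IsOpenQuotientMap q) (hqG : ∀ a b : X, q a = q b ↔ a ∈ MulAction.orbit G b)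
    {a b : Y} (c : Path a b) : LiftsUpToHomotopy q c := by
  refine LiftsUpToHomotopy.of_local (fun y => ?_) c
  obtain ⟨p, rfl⟩ := hq.surjective y
  obtain ⟨U, hU, hp, h, h0, h1, hh⟩ := hX p
  have := contractibleSpace_image hq hqG hU hp h h0 h1 hh
  refine ⟨q '' U, hq.isOpenMap U hU, ⟨p, hp, rfl⟩, fun {a b} c hc x hx => ?_⟩
  obtain ⟨v, hv, rfl⟩ : b ∈ q '' U := hc ⟨1, c.target⟩
  obtain ⟨u, hu, hau⟩ : a ∈ q '' U := hc ⟨0, c.source⟩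
  obtain ⟨g, rfl : g • u = x⟩ := (hqG _ _).1 (hx.trans hau.symm)
  subst hx
  have hgq : ∀ z, q (g • z) = q z := fun z => (hqG _ _).2 ⟨g, rfl⟩
  let track (w : U) : Path (w : X) p :=
    { toFun := fun t => h (w, t)
      continuous_toFun := by fun_prop
      source' := by simp [h0]
      target' := h1 w }
  let γ : Path u v := (track ⟨u, hu⟩).trans (track ⟨v, hv⟩).symm
  have hγ : ∀ t, γ t ∈ U := by
    intro t
    simp only [γ, Path.trans_apply]
    split_ifs
    · exact (h _).2
    · exact (h _).2
  refine ⟨g • v, hgq v, γ.map (continuous_const_smul g), ?_⟩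
  let c₁ : Path (⟨q (g • u), hc ⟨0, c.source⟩⟩ : q '' U) ⟨q v, v, hv, rfl⟩ :=
    { toFun := fun t => ⟨q (γ t), γ t, hγ t, rfl⟩
      continuous_toFun := by fun_prop
      source' := by simp [hgq]
      target' := by simp }
  let c₂ : Path (⟨q (g • u), hc ⟨0, c.source⟩⟩ : q '' U) ⟨q v, v, hv, rfl⟩ :=
    { toFun := fun t => ⟨c t, hc ⟨t, rfl⟩⟩
      continuous_toFun := by fun_prop
      source' := by simp
      target' := by simp }
  have := (SimplyConnectedSpace.paths_homotopic c₁ c₂).map ⟨Subtype.val, continuous_subtype_val⟩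
  have heq : ((γ.map (continuous_const_smul g)).map q.continuous).cast rfl (hgq v).symm
      = c₁.map continuous_subtype_val := Path.ext (funext fun t => hgq (γ t))
  exact heq ▸ this

/-- If `g` acts on `X` with a fixed point, then paths from `x` to `g • x` become null-homotopic
in the orbit space. -/
lemma homotopic_refl_of_smul_eq [SimplyConnectedSpace X] {g : G} (hg : ∀ z, q (g • z) = q z)
    {p : X} (hp : g • p = p) {x : X} (Γ : Path x (g • x)) :
    ((Γ.map q.continuous).cast rfl (hg x).symm).Homotopic (Path.refl (q x)) := by
  let α : Path x p := PathConnectedSpace.somePath x p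
  let β : Path x (g • x) :=
    α.trans ((α.map (continuous_const_smul g)).symm.cast hp.symm rfl)
  have hβ : (β.map q.continuous).cast rfl (hg x).symm
      = (α.map q.continuous).trans (α.map q.continuous).symm := by
    ext t
    simp only [β, Path.cast_coe, Path.map_coe, Function.comp_apply, Path.trans_apply]
    split_ifs <;> simp [hg]
  refine (((SimplyConnectedSpace.paths_homotopic Γ β).map q).pathCast rfl
    (hg x).symm).trans ?_
  rw [hβ]
  exact ⟨(Path.Homotopy.reflTransSymm _).symm⟩

/-- The orbit space of a group generated by elements with fixed points, acting on a simply
connected space, is simply connected. -/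
lemma HasEquivariantContractions.simplyConnectedSpace [SimplyConnectedSpace X]
    (hX : HasEquivariantContractions G X) (hq : IsOpenQuotientMap q)
    (hqG : ∀ a b : X, q a = q b ↔ a ∈ MulAction.orbit G b)
    (hG : Subgroup.closure {g : G | ∃ p : X, g • p = p} = ⊤) : SimplyConnectedSpace Y := by
  have hgq : ∀ (g : G) z, q (g • z) = q z := fun g z => (hqG _ _).2 ⟨g, rfl⟩
  have hrefl : ∀ (g : G) (x : X),
      (Path.refl (q (g • x))).cast (hgq g x).symm (hgq g x).symm = Path.refl (q x) :=
    fun g x => Path.ext (funext fun _ => hgq g x)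
  have key : ∀ (g : G) (x : X) (Γ : Path x (g • x)),
      ((Γ.map q.continuous).cast rfl (hgq g x).symm).Homotopic (Path.refl (q x)) := by
    intro g
    induction (hG ▸ Subgroup.mem_top g : g ∈ Subgroup.closure _) using
      Subgroup.closure_induction with
    | mem g hg =>
      obtain ⟨p, hp⟩ := hg
      exact fun x Γ => homotopic_refl_of_smul_eq (hgq g) hp Γ
    | one => exact fun x Γ => homotopic_refl_of_smul_eq (hgq 1) (one_smul G x) Γ
    | mul g g' _ _ ih ih' =>
      intro x Γ
      let α : Path x (g' • x) := PathConnectedSpace.somePath _ _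
      let β : Path (g' • x) (g • g' • x) := PathConnectedSpace.somePath _ _
      have h : Γ.Homotopic ((α.trans β).cast rfl (mul_smul g g' x)) :=
        SimplyConnectedSpace.paths_homotopic _ _
      refine ((h.map q).pathCast rfl (hgq _ x).symm).trans ?_
      have hα := ih' x α
      have hβ := (ih (g' • x) β).pathCast (hgq g' x).symm (hgq g' x).symm
      rw [hrefl] at hβ
      convert (hα.hcomp hβ).trans ⟨Path.Homotopy.transRefl _⟩ using 1
      ext t
      simp only [Path.cast_coe, Path.map_coe, Function.comp_apply, Path.trans_apply]
      split_ifs <;> rfl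
    | inv g _ ih =>
      intro x Γ
      have h := (ih (g⁻¹ • x) (Γ.symm.cast rfl (smul_inv_smul g x))).symm₂.pathCast
        (hgq g⁻¹ x).symm (hgq g⁻¹ x).symm
      rw [Path.refl_symm, hrefl] at h
      convert h using 1
      ext t
      simp
  have hpc : PathConnectedSpace Y := hq.surjective.pathConnectedSpace q.continuous
  refine simply_connected_iff_loops_nullhomotopic.2 ⟨hpc, fun y c => ?_⟩
  obtain ⟨x, rfl⟩ := hq.surjective y
  obtain ⟨x', hx', Γ, hΓ⟩ := hX.liftsUpToHomotopy hq hqG c x rfl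
  obtain ⟨g, rfl⟩ := (hqG _ _).1 hx'
  exact hΓ.symm.trans (key g x Γ)

end Orbit

section Covering

variable {G X : Type*} [Group G] [MulAction G X]

/-- The action of `G ⧸ N` on the orbit space of the normal subgroup `N`. -/
instance quotientGroupActionOnOrbits (N : Subgroup G) [N.Normal] :
    MulAction (G ⧸ N) (MulAction.orbitRel.Quotient N X) where
  smul := Quotient.map₂ (fun g x => g • x) (by
    rintro g g' hg _ x ⟨n, rfl⟩
    have hm : g⁻¹ * g' ∈ N := QuotientGroup.leftRel_apply.1 hg
    refine ⟨⟨g * (n * (g⁻¹ * g')⁻¹) * g⁻¹,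
      Subgroup.Normal.conj_mem inferInstance _ (N.mul_mem n.2 (N.inv_mem hm)) g⟩, ?_⟩
    simp only [Subgroup.smul_def, smul_smul]
    congr 1
    group)
  one_smul := by
    rintro ⟨x⟩
    exact congrArg (Quotient.mk _) (one_smul G x)
  mul_smul := by
    rintro ⟨g⟩ ⟨g'⟩ ⟨x⟩
    exact congrArg (Quotient.mk _) (mul_smul g g' x)

variable {Y : Type*} [TopologicalSpace X] [TopologicalSpace Y] [ContinuousConstSMul G X]
  {q : C(X, Y)}

/-- The orbit space of a normal subgroup `N` containing all elements with fixed points covers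
the orbit space of the whole group, with deck group `G ⧸ N`. -/
lemma HasEquivariantContractions.isQuotientCoveringMap (hX : HasEquivariantContractions G X)
    (hq : IsOpenQuotientMap q) (hqG : ∀ a b : X, q a = q b ↔ a ∈ MulAction.orbit G b)
    (N : Subgroup G) [N.Normal] (hN : ∀ (g : G) (p : X), g • p = p → g ∈ N) :
    IsQuotientCoveringMap
      (Quotient.lift q fun a b (h : MulAction.orbitRel N X a b) =>
        (hqG a b).2 (let ⟨n, hn⟩ := h; ⟨n, hn⟩) : MulAction.orbitRel.Quotient N X → Y)
      (G ⧸ N) := by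
  have hNc : ContinuousConstSMul N X := ⟨fun n => continuous_const_smul (n : G)⟩
  have hr : IsOpenQuotientMap (Quotient.mk (MulAction.orbitRel N X)) :=
    MulAction.isOpenQuotientMap_quotientMk
  have hcont : ContinuousConstSMul (G ⧸ N) (MulAction.orbitRel.Quotient N X) := by
    refine ⟨fun g => ?_⟩
    obtain ⟨g, rfl⟩ := QuotientGroup.mk_surjective g
    exact hr.continuous_comp_iff.1 (hr.continuous.comp (continuous_const_smul g))
  refine { toContinuousConstSMul := hcont, toIsQuotientMap := ?_, apply_eq_iff_mem_orbit := ?_,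
           disjoint := ?_ }
  · exact .of_comp hr.continuous (hr.continuous_comp_iff.1 q.continuous) hq.isQuotientMap
  · rintro ⟨a⟩ ⟨b⟩
    refine (hqG a b).trans ⟨?_, ?_⟩
    · rintro ⟨g, rfl⟩
      exact ⟨(g : G ⧸ N), rfl⟩
    · rintro ⟨⟨g⟩, hg⟩
      obtain ⟨n, hn⟩ := Quotient.exact hg
      refine ⟨(n : G)⁻¹ * g, ?_⟩
      change ((n : G)⁻¹ * g) • b = a
      rw [mul_smul, inv_smul_eq_iff]
      exact hn.symm
  · rintro ⟨p⟩
    obtain ⟨U, hU, hp, h, -, h1, hh⟩ := hX p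
    refine ⟨Quotient.mk _ '' U, (hr.isOpenMap U hU).mem_nhds ⟨p, hp, rfl⟩, ?_⟩
    rintro ⟨g⟩ ⟨_, ⟨_, ⟨u, hu, rfl⟩, hgu⟩, u', hu', rfl⟩
    obtain ⟨n, hn⟩ := Quotient.exact hgu
    have hfix := hh ((n : G)⁻¹ * g) ⟨u, hu⟩ ⟨u', hu'⟩
      (by rw [mul_smul, inv_smul_eq_iff]; exact hn.symm) 1
    rw [h1, h1] at hfix
    have hmem := N.mul_mem n.2 (hN _ _ hfix)
    rw [mul_inv_cancel_left] at hmem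
    exact (QuotientGroup.eq_one_iff g).2 hmem

/-- Armstrong's theorem for actions with equivariant local contractions. -/
theorem HasEquivariantContractions.nonempty_mulEquiv_fundamentalGroup [SimplyConnectedSpace X]
    (hX : HasEquivariantContractions G X) (hq : IsOpenQuotientMap q)
    (hqG : ∀ a b : X, q a = q b ↔ a ∈ MulAction.orbit G b) (x : X) :
    Nonempty ((G ⧸ Subgroup.normalClosure {g : G | ∃ p : X, g • p = p}) ≃*
      FundamentalGroup Y (q x)) := by
  set S : Set G := {g : G | ∃ p : X, g • p = p}
  set N := Subgroup.normalClosure S with hNdef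
  have hSN : ∀ g ∈ S, g ∈ N := fun g hg => Subgroup.subset_normalClosure hg
  have hconj : Group.conjugatesOfSet S = S := by
    refine Group.subset_conjugatesOfSet.antisymm' fun g hg => ?_
    obtain ⟨a, ⟨p, hp⟩, ha⟩ := Group.mem_conjugatesOfSet_iff.1 hg
    obtain ⟨c, rfl⟩ := isConj_iff.1 ha
    exact ⟨c • p, by simp [mul_smul, hp]⟩
  have hNcl : Subgroup.closure {n : N | ∃ p : X, n • p = p} = ⊤ := by
    have hcl : N = Subgroup.closure S := by rw [hNdef, Subgroup.normalClosure, hconj]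
    rw [← Subgroup.map_injective N.subtype_injective |>.eq_iff, MonoidHom.map_closure]
    have himg : N.subtype '' {n : N | ∃ p : X, n • p = p} = S := by
      ext g
      constructor
      · rintro ⟨n, hn, rfl⟩
        exact hn
      · exact fun hg => ⟨⟨g, hSN g hg⟩, hg, rfl⟩
    rw [himg, ← hcl, ← MonoidHom.range_eq_map, Subgroup.range_subtype]
  have hNc : ContinuousConstSMul N X := ⟨fun n => continuous_const_smul (n : G)⟩
  have hr : IsOpenQuotientMap (Quotient.mk (MulAction.orbitRel N X)) :=
    MulAction.isOpenQuotientMap_quotientMk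
  have hsc : SimplyConnectedSpace (MulAction.orbitRel.Quotient N X) :=
    (hX.subgroup N).simplyConnectedSpace (q := ⟨_, hr.continuous⟩) hr (fun a b => Quotient.eq) hNcl
  have hcov := hX.isQuotientCoveringMap hq hqG N fun g p hg => hSN g ⟨p, hg⟩
  exact ⟨(MulEquiv.inv' (G ⧸ N)).trans
    (hcov.fundamentalGroupEquiv ⟨Quotient.mk _ x, rfl⟩).symm⟩

end Covering

section GeometricRealization

variable {V : Type} {K : Set (Finset V)} {f f' : V → ℝ}

lemma sum_eq_one_of_support_subset {s T : Finset V} (hs : ∀ v, v ∉ s → f v = 0)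
    (hsum : ∑ v ∈ s, f v = 1) (hT : ∀ v, v ∉ T → f v = 0) : ∑ v ∈ T, f v = 1 := by
  classical
  rw [← hsum, Finset.sum_subset (Finset.subset_union_left (s₂ := s)) fun v _ hv => hT v hv,
    Finset.sum_subset (Finset.subset_union_right (s₁ := T)) fun v _ hv => hs v hv]

lemma sum_le_one_of_mem_geomReal (hf : f ∈ geomReal K) (T : Finset V) : ∑ v ∈ T, f v ≤ 1 := by
  classical
  obtain ⟨h0, s, -, hs, hsum⟩ := hf
  rw [← sum_eq_one_of_support_subset hs hsum (T := T ∪ s) fun v hv => hs v (by simp_all)]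
  exact Finset.sum_le_sum_of_subset_of_nonneg Finset.subset_union_left fun v _ _ => h0 v

lemma exists_lt_of_mem_geomReal_of_ne (hf : f ∈ geomReal K) (hf' : f' ∈ geomReal K)
    (hne : f' ≠ f) : ∃ v, f v < f' v := by
  classical
  by_contra! hle
  obtain ⟨-, s, -, hs, hsum⟩ := hf
  obtain ⟨-, s', -, hs', hsum'⟩ := hf'
  have h := sum_eq_one_of_support_subset hs hsum (T := s ∪ s') fun v hv => hs v (by simp_all)
  have h' := sum_eq_one_of_support_subset hs' hsum' (T := s ∪ s') fun v hv => hs' v (by simp_all)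
  have heq := (Finset.sum_eq_sum_iff_of_le fun v _ => hle v).1 (h'.trans h.symm)
  refine hne (funext fun v => ?_)
  by_cases hv : v ∈ s ∪ s'
  · exact heq v hv
  · rw [hs v (by simp_all), hs' v (by simp_all)]

lemma exists_pos_forall_le_of_pos (F : Finset ℝ) : ∃ m > 0, ∀ x ∈ F, 0 < x → m ≤ x := by
  classical
  induction F using Finset.induction_on with
  | empty => exact ⟨1, one_pos, by simp⟩
  | insert a F _ ih =>
    obtain ⟨m, hm, hF⟩ := ih
    by_cases ha : 0 < a
    · refine ⟨min a m, lt_min ha hm, fun x hx hx0 => ?_⟩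
      rcases Finset.mem_insert.1 hx with rfl | hx
      · exact min_le_left _ _
      · exact (min_le_right _ _).trans (hF x hx hx0)
    · refine ⟨m, hm, fun x hx hx0 => ?_⟩
      rcases Finset.mem_insert.1 hx with rfl | hx
      · exact absurd hx0 ha
      · exact hF x hx hx0

/-- The finitely many values of a point of the realization are uniformly separated. -/
lemma exists_gap_of_mem_geomReal (hf : f ∈ geomReal K) :
    ∃ m > 0, (∀ v, 0 < f v → m ≤ f v) ∧ ∀ v w, f v < f w → f v + m ≤ f w := by
  classical
  obtain ⟨h0, s, -, hs, -⟩ := hf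
  obtain ⟨m, hm, hF⟩ := exists_pos_forall_le_of_pos
    (s.image f ∪ (s ×ˢ s).image fun vw => f vw.2 - f vw.1)
  have hpos : ∀ v, 0 < f v → v ∈ s := fun v hv => by
    by_contra hvs
    exact hv.ne' (hs v hvs)
  have hval : ∀ v, 0 < f v → m ≤ f v := fun v hv =>
    hF _ (Finset.mem_union_left _ (Finset.mem_image_of_mem f (hpos v hv))) hv
  refine ⟨m, hm, hval, fun v w hvw => ?_⟩
  have hw := hpos w ((h0 v).trans_lt hvw)
  by_cases hv : v ∈ s
  · have := hF (f w - f v) (Finset.mem_union_right _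
      (Finset.mem_image.2 ⟨(v, w), Finset.mk_mem_product hv hw, rfl⟩)) (sub_pos.2 hvw)
    linarith
  · rw [hs v hv] at hvw ⊢
    linarith [hval w hvw]

/-- A segment joining two points of the realization stays in it if the support of the second
point lies in the support of the first. -/
lemma segment_mem_geomReal (hf : f ∈ geomReal K) (hf' : f' ∈ geomReal K)
    (hsupp : ∀ v, 0 < f' v → 0 < f v) {t : ℝ} (ht0 : 0 ≤ t) (ht1 : t ≤ 1) :
    (fun v => (1 - t) * f v + t * f' v) ∈ geomReal K := by
  obtain ⟨h0, s, hsK, hs, hsum⟩ := hf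
  obtain ⟨h0', s', -, hs', hsum'⟩ := hf'
  have hs'' : ∀ v, v ∉ s → f' v = 0 := fun v hv => by
    by_contra hne
    exact (hsupp v ((h0' v).lt_of_ne' hne)).ne' (hs v hv)
  refine ⟨fun v => ?_, s, hsK, fun v hv => ?_, ?_⟩
  · have := h0 v
    have := h0' v
    have : 0 ≤ 1 - t := by linarith
    positivity
  · simp [hs v hv, hs'' v hv]
  · rw [Finset.sum_add_distrib, ← Finset.mul_sum, ← Finset.mul_sum, hsum,
      sum_eq_one_of_support_subset hs' hsum' hs'']
    ring

variable {G : Type} [Group G] [DecidableEq V] {ρ : G →* Equiv.Perm V}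

lemma simpAct_mem_geomReal (hρ : ∀ (g : G), ∀ s ∈ K, Finset.image (ρ g) s ∈ K) (g : G)
    (hf : f ∈ geomReal K) : simpAct ρ g f ∈ geomReal K := by
  obtain ⟨h0, s, hsK, hs, hsum⟩ := hf
  refine ⟨fun v => h0 _, s.image (ρ g), hρ g s hsK, fun v hv => hs _ fun hvs => hv ?_, ?_⟩
  · exact Finset.mem_image.2 ⟨_, hvs, by simp⟩
  · rw [Finset.sum_image (ρ g).injective.injOn]
    simpa [simpAct] using hsum

/-- The action on the realization induced by a simplicial action on the vertices. -/
@[reducible] def geomRealMulAction (hρ : ∀ (g : G), ∀ s ∈ K, Finset.image (ρ g) s ∈ K) :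
    MulAction G (geomReal K) where
  smul g p := ⟨simpAct ρ g p, simpAct_mem_geomReal hρ g p.2⟩
  one_smul p := Subtype.ext (funext fun v => by
    change (p : V → ℝ) ((ρ 1).symm v) = _
    rw [map_one]
    rfl)
  mul_smul g g' p := Subtype.ext (funext fun v => by
    change (p : V → ℝ) ((ρ (g * g')).symm v) = (p : V → ℝ) ((ρ g').symm ((ρ g).symm v))
    simp [Equiv.Perm.mul_def])

/-- Two points that are sufficiently close from above to `p` are related by `g` only if `g`
fixes `p`. -/
lemma simpAct_eq_self_of_close (hρ : ∀ (g : G), ∀ s ∈ K, Finset.image (ρ g) s ∈ K)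
    {p : V → ℝ} (hp : p ∈ geomReal K) {s : Finset V} (hs : ∀ v, v ∉ s → p v = 0)
    (hsum : ∑ v ∈ s, p v = 1) {m ε : ℝ} (hgap : ∀ v w, p v < p w → p v + m ≤ p w)
    (hε : (s.card + 1) * ε < m) (hε0 : 0 ≤ ε) (hf' : f' ∈ geomReal K)
    (hu : ∀ v ∈ s, p v - ε < f v) (hu' : ∀ v ∈ s, p v - ε < f' v)
    {g : G} (hg : simpAct ρ g f = f') : simpAct ρ g p = p := by
  by_contra hne
  obtain ⟨w, hw⟩ := exists_lt_of_mem_geomReal_of_ne hp (simpAct_mem_geomReal hρ g hp) hne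
  have hgw : p w + m ≤ p ((ρ g).symm w) := hgap _ _ hw
  have hws : (ρ g).symm w ∈ s := by
    by_contra hws
    exact (hp.1 w).not_gt ((hs _ hws) ▸ hw)
  have hfw : p w + m - ε < f' w := by
    have h1 := hu _ hws
    rw [← hg]
    change _ < f ((ρ g).symm w)
    linarith
  have hlow : ∀ v ∈ insert w s, p v - ε + (if v = w then m else 0) ≤ f' v := by
    intro v hv
    split_ifs with h
    · subst h; linarith
    · have := hu' v (Finset.mem_of_mem_insert_of_ne hv h)
      linarith
  have hle := (Finset.sum_le_sum hlow).trans (sum_le_one_of_mem_geomReal hf' _)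
  rw [Finset.sum_add_distrib, Finset.sum_sub_distrib, Finset.sum_ite_eq',
    if_pos (Finset.mem_insert_self w s), Finset.sum_const, nsmul_eq_mul,
    sum_eq_one_of_support_subset hs hsum fun v hv => hs v fun h => hv (Finset.mem_insert_of_mem h)]
    at hle
  have hcard : ((insert w s).card : ℝ) ≤ s.card + 1 := by
    exact_mod_cast Finset.card_insert_le w s
  nlinarith [mul_le_mul_of_nonneg_right hcard hε0]

lemma hasEquivariantContractions_geomReal
    (hρ : ∀ (g : G), ∀ s ∈ K, Finset.image (ρ g) s ∈ K) :
    letI := geomRealMulAction hρ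
    HasEquivariantContractions G (geomReal K) := by
  let _ := geomRealMulAction hρ
  rintro ⟨p, hp⟩
  obtain ⟨m, hm, hval, hgap⟩ := exists_gap_of_mem_geomReal hp
  obtain ⟨-, s, -, hs, hsum⟩ := id hp
  have hcard : (0 : ℝ) < s.card + 2 := by positivity
  set ε := m / (s.card + 2) with hεdef
  have hε0 : 0 < ε := div_pos hm hcard
  have hεm : (s.card + 2) * ε = m := by rw [hεdef]; field_simp
  have hε : (s.card + 1) * ε < m := by linarith
  have hεm' : ε < m := by nlinarith [(Nat.cast_nonneg s.card : (0 : ℝ) ≤ s.card)]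
  let U : Set (geomReal K) := {f | ∀ v ∈ s, p v - ε < (f : V → ℝ) v}
  have hpU : (⟨p, hp⟩ : geomReal K) ∈ U := fun v _ => by
    change p v - ε < p v
    linarith
  have hUo : IsOpen U := by
    have : U = ⋂ v ∈ s, {f : geomReal K | p v - ε < (f : V → ℝ) v} := by ext; simp [U]
    rw [this]
    exact isOpen_biInter_finset fun v _ =>
      isOpen_lt continuous_const ((continuous_apply v).comp continuous_subtype_val)
  have hsupp : ∀ f ∈ U, ∀ v, 0 < p v → 0 < (f : V → ℝ) v := fun f hf v hv => by
    have hvs : v ∈ s := by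
      by_contra hvs
      exact hv.ne' (hs v hvs)
    linarith [hf v hvs, hval v hv]
  have hsegU : ∀ (f : U) (t : I),
      (⟨_, segment_mem_geomReal f.1.2 hp (hsupp f.1 f.2) t.2.1 t.2.2⟩ : geomReal K) ∈ U := by
    intro f t v hv
    change p v - ε < (1 - (t : ℝ)) * (f : V → ℝ) v + t * p v
    have hfv := f.2 v hv
    rcases eq_or_lt_of_le t.2.2 with h1 | h1
    · rw [h1]; linarith
    · nlinarith [t.2.1, mul_pos (sub_pos.2 h1) (sub_pos.2 hfv), mul_nonneg t.2.1 hε0.le]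
  refine ⟨U, hUo, hpU, ⟨fun ft => ⟨⟨_, segment_mem_geomReal ft.1.1.2 hp (hsupp ft.1.1 ft.1.2)
    ft.2.2.1 ft.2.2.2⟩, hsegU ft.1 ft.2⟩, ?_⟩, fun f => ?_, fun f => ?_, fun g f f' hg t => ?_⟩
  · refine Continuous.subtype_mk (Continuous.subtype_mk (continuous_pi fun v => ?_) _) _
    have : Continuous fun ft : U × I => ((ft.1 : geomReal K) : V → ℝ) v :=
      (continuous_apply v).comp
        (continuous_subtype_val.comp (continuous_subtype_val.comp continuous_fst))
    fun_prop
  · refine Subtype.ext (Subtype.ext (funext fun v => ?_))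
    simp
  · refine Subtype.ext (funext fun v => ?_)
    simp
  · have hgf : simpAct ρ g (f : V → ℝ) = (f' : V → ℝ) := congrArg Subtype.val hg
    have hgp := simpAct_eq_self_of_close hρ hp hs hsum hgap hε hε0.le f'.1.2 f.2 f'.2 hgf
    refine Subtype.ext (funext fun v => ?_)
    change (1 - (t : ℝ)) * (f : V → ℝ) ((ρ g).symm v) + t * p ((ρ g).symm v) =
      (1 - (t : ℝ)) * (f' : V → ℝ) v + t * p v
    rw [← congrFun hgf v]
    exact congrArg (fun y => (1 - (t : ℝ)) * simpAct ρ g (f : V → ℝ) v + t * y) (congrFun hgp v)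

end GeometricRealization

/-- Armstrong's theorem: if `X` is a simply connected simplicial complex and `G` acts
on `X` simplicially, then the fundamental group of the orbit space `X/G` is isomorphic
to `G/G_*`, where `G_*` is the normal subgroup of `G` generated by the elements having
a fixed point in `X`. -/
theorem armstrong_fundamental_group_of_quotient
    (G V : Type) [Group G] [DecidableEq V] (K : Set (Finset V)) (ρ : G →* Equiv.Perm V)
    (hsimplicial : ∀ (g : G), ∀ s ∈ K, Finset.image (ρ g) s ∈ K)
    (hfaithful : Function.Injective ρ)
    (hsc : SimplyConnectedSpace (geomReal K))
    (x : geomReal K) :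
    Nonempty
      ((G ⧸ Subgroup.normalClosure
          {g : G | ∃ p ∈ geomReal K, simpAct ρ g p = p}) ≃*
        FundamentalGroup (Quot (orbitRel' K ρ)) (Quot.mk _ x)) := by
  let _ := geomRealMulAction hsimplicial
  have hcont : ContinuousConstSMul G (geomReal K) := ⟨fun g =>
    continuous_induced_rng.2 (continuous_pi fun v =>
      (continuous_apply ((ρ g).symm v)).comp continuous_subtype_val)⟩
  have hrel : ∀ a b : geomReal K, orbitRel' K ρ a b ↔ b ∈ MulAction.orbit G a := fun a b =>
    exists_congr fun _ => ⟨fun h => Subtype.ext h, fun h => congrArg Subtype.val h⟩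
  have hqG : ∀ a b : geomReal K,
      Quot.mk (orbitRel' K ρ) a = Quot.mk (orbitRel' K ρ) b ↔ a ∈ MulAction.orbit G b := by
    intro a b
    have hequiv : Equivalence (orbitRel' K ρ) :=
      { refl := fun a => (hrel a a).2 (MulAction.mem_orbit_self a)
        symm := fun h => (hrel _ _).2 (MulAction.mem_orbit_symm.1 ((hrel _ _).1 h))
        trans := fun h h' => (hrel _ _).2
          (MulAction.orbit_eq_iff.2 ((hrel _ _).1 h) ▸ (hrel _ _).1 h') }
    rw [hequiv.quot_mk_eq_iff, hrel, MulAction.mem_orbit_symm]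
  have hq : IsOpenQuotientMap (Quot.mk (orbitRel' K ρ)) := by
    refine ⟨Quot.mk_surjective, continuous_quot_mk, fun U hU => ?_⟩
    have hpre : Quot.mk (orbitRel' K ρ) ⁻¹' (Quot.mk (orbitRel' K ρ) '' U) =
        ⋃ g : G, (fun a => g • a) '' U := by
      ext a
      simp only [Set.mem_preimage, Set.mem_image, Set.mem_iUnion]
      constructor
      · rintro ⟨u, hu, hau⟩
        obtain ⟨g, hg⟩ := (hqG _ _).1 hau.symm
        exact ⟨g, u, hu, hg⟩
      · rintro ⟨g, u, hu, rfl⟩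
        exact ⟨u, hu, ((hqG _ _).2 ⟨g, rfl⟩).symm⟩
    rw [← isQuotientMap_quot_mk.isOpen_preimage, hpre]
    exact isOpen_iUnion fun g => isOpenMap_smul g U hU
  have hfix : {g : G | ∃ p ∈ geomReal K, simpAct ρ g p = p} =
      {g : G | ∃ p : geomReal K, g • p = p} := by
    ext g
    constructor
    · rintro ⟨p, hp, hg⟩
      exact ⟨⟨p, hp⟩, Subtype.ext hg⟩
    · rintro ⟨p, hg⟩
      exact ⟨p, p.2, congrArg Subtype.val hg⟩
  rw [hfix]
  exact (hasEquivariantContractions_geomReal hsimplicial).nonempty_mulEquiv_fundamentalGroup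
    (q := ⟨_, hq.continuous⟩) hq hqG x
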